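/- Let n ≥ 11 and let R be a subset of the vertex set of P(n,2) with u_{t−1}, u_{t+2}, u_{t+5} ∈ R and u_{t+1}, v_{t+1}, v_{t+2}, u_{t+3}, v_{t+3} ∉ R. Then the edge u_{t+1} u_{t+3} belongs to every perfect matching of the induced subgraph P(n,2) − R, provided such a perfect matching exists. -/

import Mathlib

open SimpleGraph

/-- Vertices of the generalized Petersen graph `P(n,2)`:
`Sum.inl i` is the outer vertex `u_i`, `Sum.inr i` is the inner vertex `v_i`. -/
abbrev PV (n : ℕ) := ZMod n ⊕ ZMod n

/-- The outer vertex `u_i`. -/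
def pu {n : ℕ} (i : ZMod n) : PV n := Sum.inl i

/-- The inner vertex `v_i`. -/
def pv {n : ℕ} (i : ZMod n) : PV n := Sum.inr i

/-- The generalized Petersen graph `P(n,2)`, with edges
`u_i u_{i+2}`, `u_i v_i` (spokes) and `v_i v_{i+1}`, indices mod `n`. -/
def petersen (n : ℕ) : SimpleGraph (PV n) :=
  SimpleGraph.fromRel (fun x y =>
    (∃ i : ZMod n, x = pu i ∧ y = pu (i + 2)) ∨
    (∃ i : ZMod n, x = pu i ∧ y = pv i) ∨
    (∃ i : ZMod n, x = pv i ∧ y = pv (i + 1)))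

/-- `S` is a forcing set of the perfect matching `M` of `G`:
`S ⊆ M` and `S` is contained in no other perfect matching of `G`. -/
def IsForcingSet {V : Type*} (G : SimpleGraph V) (M : G.Subgraph) (S : Set (Sym2 V)) : Prop :=
  S ⊆ M.edgeSet ∧
    ∀ M' : G.Subgraph, M'.IsPerfectMatching → S ⊆ M'.edgeSet → M' = M

/-- The forcing number `f(G,M)`: the minimum cardinality of a forcing set of `M`. -/
noncomputable def forcingNumber {V : Type*} (G : SimpleGraph V) (M : G.Subgraph) : ℕ :=
  sInf {k | ∃ S : Set (Sym2 V), IsForcingSet G M S ∧ S.ncard = k}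

/-- Block `A` starting at position `i` (length 4). -/
def blockA (n : ℕ) (i : ZMod n) : Set (Sym2 (PV n)) :=
  {s(pu i, pu (i + 2)), s(pu (i + 1), pu (i + 3)), s(pv i, pv (i + 1)), s(pv (i + 2), pv (i + 3))}

/-- Block `B` at position `i` (length 1): a single spoke. -/
def blockB (n : ℕ) (i : ZMod n) : Set (Sym2 (PV n)) :=
  {s(pu i, pv i)}

/-- Block `C` starting at position `i` (length 3). -/
def blockC (n : ℕ) (i : ZMod n) : Set (Sym2 (PV n)) :=
  {s(pu i, pu (i + 2)), s(pu (i + 1), pv (i + 1)), s(pv (i + 2), pv (i + 3))}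

/-- Block `D` starting at position `i` (length 4). -/
def blockD (n : ℕ) (i : ZMod n) : Set (Sym2 (PV n)) :=
  {s(pu i, pu (i + 2)), s(pu (i + 1), pu (i + 3)), s(pv (i + 1), pv (i + 2)), s(pv (i + 3), pv (i + 4))}

/-- Length of an `A`/`B` block: `true` codes `A` (length 4), `false` codes `B` (length 1). -/
def abLen (b : Bool) : ℕ := if b then 4 else 1

/-- Edge set of a concatenation of `A`/`B` blocks starting at position `i`. -/
def abEdges (n : ℕ) : ZMod n → List Bool → Set (Sym2 (PV n))
  | _, [] => ∅
  | i, true :: L => blockA n i ∪ abEdges n (i + 4) L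
  | i, false :: L => blockB n i ∪ abEdges n (i + 1) L

/-- A perfect matching (given as a subgraph of `P(n,2)`) has type 1 if its edge set is
a cyclic concatenation of `A` and `B` blocks whose lengths sum to `n`. -/
def IsType1 {n : ℕ} (M : (petersen n).Subgraph) : Prop :=
  ∃ (i : ZMod n) (L : List Bool), (L.map abLen).sum = n ∧ M.edgeSet = abEdges n i L

/-- Length of a `C`/`D` block: `true` codes `C` (length 3), `false` codes `D` (length 4). -/
def cdLen (b : Bool) : ℕ := if b then 3 else 4

/-- Edge set of a concatenation of `C`/`D` blocks starting at position `i`. -/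
def cdEdges (n : ℕ) : ZMod n → List Bool → Set (Sym2 (PV n))
  | _, [] => ∅
  | i, true :: L => blockC n i ∪ cdEdges n (i + 3) L
  | i, false :: L => blockD n i ∪ cdEdges n (i + 4) L

/-- A perfect matching (given as a subgraph of `P(n,2)`) has type 2 if its edge set is
a cyclic concatenation of `C` and `D` blocks whose lengths sum to `n`. -/
def IsType2 {n : ℕ} (M : (petersen n).Subgraph) : Prop :=
  ∃ (i : ZMod n) (L : List Bool), (L.map cdLen).sum = n ∧ M.edgeSet = cdEdges n i L

theorem petersen_adj_pu {n : ℕ} {i : ZMod n} {y : PV n} (h : (petersen n).Adj (pu i) y) :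
    y = pu (i - 2) ∨ y = pu (i + 2) ∨ y = pv i := by
  rw [petersen, SimpleGraph.fromRel_adj] at h
  obtain ⟨-, (⟨j, hj, rfl⟩ | ⟨j, hj, rfl⟩ | ⟨j, hj, rfl⟩) |
    (⟨j, rfl, hj⟩ | ⟨j, rfl, hj⟩ | ⟨j, rfl, hj⟩)⟩ := h <;> simp_all [pu, pv]

theorem petersen_adj_pv {n : ℕ} {i : ZMod n} {y : PV n} (h : (petersen n).Adj (pv i) y) :
    y = pv (i - 1) ∨ y = pv (i + 1) ∨ y = pu i := by
  rw [petersen, SimpleGraph.fromRel_adj] at h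
  obtain ⟨-, (⟨j, hj, rfl⟩ | ⟨j, hj, rfl⟩ | ⟨j, hj, rfl⟩) |
    (⟨j, rfl, hj⟩ | ⟨j, rfl, hj⟩ | ⟨j, rfl, hj⟩)⟩ := h <;> simp_all [pu, pv]

/-- if `u_{t-1}, u_{t+2}, u_{t+5} ∈ R` and
`u_{t+1}, v_{t+1}, v_{t+2}, u_{t+3}, v_{t+3} ∉ R`, then the edge `u_{t+1} u_{t+3}`
belongs to every perfect matching of `P(n,2) − R` (formalized as a matching subgraph
of `P(n,2)` whose vertex set is exactly the complement of `R`). -/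
theorem forced_outer_edge (n : ℕ) (hn : 11 ≤ n) (t : ZMod n) (R : Set (PV n))
    (h1 : pu (t - 1) ∈ R) (h2 : pu (t + 2) ∈ R) (h3 : pu (t + 5) ∈ R)
    (h4 : pu (t + 1) ∉ R) (h5 : pv (t + 1) ∉ R) (h6 : pv (t + 2) ∉ R)
    (h7 : pu (t + 3) ∉ R) (h8 : pv (t + 3) ∉ R)
    (M : (petersen n).Subgraph) (hM : M.IsMatching) (hV : M.verts = Rᶜ) :
    s(pu (t + 1), pu (t + 3)) ∈ M.edgeSet := by
  have notMem {x y : PV n} (h : M.Adj x y) : y ∉ R := by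
    have := h.snd_mem
    rwa [hV] at this
  have exists_adj {x : PV n} (hx : x ∉ R) : ∃ y, M.Adj x y :=
    (hM (by rwa [hV])).exists
  rw [SimpleGraph.Subgraph.mem_edgeSet]
  by_contra hne
  have spoke₁ : M.Adj (pu (t + 1)) (pv (t + 1)) := by
    obtain ⟨y, hy⟩ := exists_adj h4
    rcases petersen_adj_pu hy.adj_sub with rfl | rfl | rfl
    · rw [show t + 1 - 2 = t - 1 by ring] at hy
      exact absurd h1 (notMem hy)
    · rw [show t + 1 + 2 = t + 3 by ring] at hy
      exact absurd hy hne
    · exact hy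
  have spoke₃ : M.Adj (pu (t + 3)) (pv (t + 3)) := by
    obtain ⟨y, hy⟩ := exists_adj h7
    rcases petersen_adj_pu hy.adj_sub with rfl | rfl | rfl
    · rw [show t + 3 - 2 = t + 1 by ring] at hy
      exact absurd hy.symm hne
    · rw [show t + 3 + 2 = t + 5 by ring] at hy
      exact absurd h3 (notMem hy)
    · exact hy
  obtain ⟨y, hy⟩ := exists_adj h6
  rcases petersen_adj_pv hy.adj_sub with rfl | rfl | rfl
  · rw [show t + 2 - 1 = t + 1 by ring] at hy
    exact Sum.inl_ne_inr (hM.eq_of_adj_right spoke₁ hy)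
  · rw [show t + 2 + 1 = t + 3 by ring] at hy
    exact Sum.inl_ne_inr (hM.eq_of_adj_right spoke₃ hy)
  · exact notMem hy h2
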